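/- Let C be a category with binary coproducts and let a be an object of C, with codiagonal ∇ : a ⨿ a → a (the copairing of the identity with itself). Then the square with the two parallel morphisms ∇ ⨿ id : (a ⨿ a) ⨿ a → a ⨿ a and (associator) ≫ (id ⨿ ∇) : (a ⨿ a) ⨿ a → a ⨿ a out of (a ⨿ a) ⨿ a, and the codiagonal ∇ : a ⨿ a → a on both remaining sides, is a pushout square. -/

import Mathlib

open CategoryTheory CategoryTheory.Limits

universe u v

/-- **The codiagonal pushout square.**  In a category with binary coproducts, the square
with parallel morphisms `∇ ⨿ 𝟙 : (a ⨿ a) ⨿ a ⟶ a ⨿ a` and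
`(associator) ≫ (𝟙 ⨿ ∇) : (a ⨿ a) ⨿ a ⟶ a ⨿ a`, and with the codiagonal
`∇ : a ⨿ a ⟶ a` on the two remaining sides, is a pushout square. -/
theorem isPushout_codiag
    {C : Type u} [Category.{v} C] [HasBinaryCoproducts C] (a : C) :
    IsPushout (coprod.map (codiag a) (𝟙 a))
      ((coprod.associator a a a).hom ≫ coprod.map (𝟙 a) (codiag a))
      (codiag a) (codiag a) := by
  refine ⟨⟨?_⟩, ⟨PushoutCocone.IsColimit.mk _ (fun s => coprod.inl ≫ s.inl) ?_ ?_ ?_⟩⟩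
  · ext <;> simp [coprod.inl_desc, coprod.inr_desc]
  all_goals
    intro s
    have h₁ : coprod.inl ≫ s.inl = coprod.inl ≫ s.inr := by
      simpa [coprod.inl_desc, coprod.inr_desc] using
        congrArg ((coprod.inl ≫ coprod.inl) ≫ ·) s.condition
    have h₂ : coprod.inl ≫ s.inl = coprod.inr ≫ s.inr := by
      simpa [coprod.inl_desc, coprod.inr_desc] using
        congrArg ((coprod.inr ≫ coprod.inl) ≫ ·) s.condition
    have h₃ : coprod.inr ≫ s.inl = coprod.inr ≫ s.inr := by
      simpa [coprod.inl_desc, coprod.inr_desc] using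
        congrArg (coprod.inr ≫ ·) s.condition
  · ext
    · simp [coprod.inl_desc]
    · simp [coprod.inr_desc, h₂, h₃]
  · ext
    · simp [coprod.inl_desc, h₁]
    · simp [coprod.inr_desc, h₂]
  · intro m hm _
    simp [← hm, coprod.inl_desc]
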